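/- Let A = (1, 4, 9, ...) be the sequence of perfect squares, a_k = k². For all integers n ≥ 70, the scoreboard value satisfies A^φ(n) = φ(1+φ(4+φ(9+...+φ(n²)...))) = 16. -/

import Mathlib

/-- `scorePartial a n j` is the partial evaluation `A^φ(n, n - j)` of the
adversarial totient iteration for the sequence `a` (indexed from 1):
`scorePartial a n 0 = 0` corresponds to `A^φ(n,n) = 0`, and
`scorePartial a n (j+1) = φ(a (n-j) + scorePartial a n j)` corresponds to the
recurrence `A^φ(n,k-1) = φ(a_k + A^φ(n,k))` with `k = n - j`.
Hence `A^φ(n,k) = scorePartial a n (n - k)`, and the scoreboard function is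
`A^φ(n) = A^φ(n,0) = scorePartial a n n`. -/
def scorePartial (a : ℕ → ℕ) (n : ℕ) : ℕ → ℕ
  | 0 => 0
  | j + 1 => Nat.totient (a (n - j) + scorePartial a n j)

/-- The primes below `257`. -/
def smallPrimes : List ℕ :=
  [2, 3, 5, 7, 11, 13, 17, 19, 23, 29, 31, 37, 41, 43, 47, 53, 59, 61, 67, 71, 73, 79, 83, 89,
    97, 101, 103, 107, 109, 113, 127, 131, 137, 139, 149, 151, 157, 163, 167, 173, 179, 181,
    191, 193, 197, 199, 211, 223, 227, 229, 233, 239, 241, 251]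

/-- The product of the primes below `257`. -/
def smallPrimorial : ℕ :=
  64266330917908644872330635228106713310880186591609208114244758680898150367880703152525200743234420230

/-- Totient by trial division along a list of primes, with `Nat.totient` itself as fallback. -/
noncomputable def trialTotient (ps : List ℕ) : ℕ → ℕ :=
  List.rec (motive := fun _ => ℕ → ℕ) Nat.totient
    (fun p _ ih m => bif Nat.blt m (Nat.mul p p) then (bif Nat.beq m 1 then 1 else Nat.pred m)
      else bif Nat.beq (Nat.mod m p) 0 then
        bif Nat.beq (Nat.mod (Nat.div m p) p) 0 then Nat.totient m
          else Nat.mul (Nat.pred p) (ih (Nat.div m p))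
      else ih m) ps

/-- Totient that splits off the part of `m` with prime factors below `257`; what is left of an
`m < 257 ^ 2` is `1` or a prime. -/
noncomputable def fastTotient (m : ℕ) : ℕ :=
  (fun g => (fun G => (fun q =>
    bif and (Nat.blt m 66049) (Nat.beq (Nat.gcd G q) 1) then
      Nat.mul (Nat.mul (Nat.div G g) (trialTotient smallPrimes g))
        (bif Nat.beq q 1 then 1 else Nat.pred q)
    else Nat.totient m) (Nat.div m G)) (Nat.gcd m (Nat.pow g 16))) (Nat.gcd m smallPrimorial)

/-- A set `S` of even numbers is encoded by the natural number whose `i`-th bit says whether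
`2 * i ∈ S`. If `S` is encoded by `mask`, then `totientImage s d mask 0` encodes
`{φ (s + x) | x ∈ S, x < 2 ^ (d + 1)}`. -/
noncomputable def totientImage (s : ℕ) : ℕ → ℕ → ℕ → ℕ
  | 0, mask, off => bif Nat.beq mask 0 then 0 else
      Nat.shiftLeft 1 (Nat.div (fastTotient (Nat.add s (Nat.mul 2 off))) 2)
  | d + 1, mask, off => bif Nat.beq mask 0 then 0 else
      Nat.lor (totientImage s d (Nat.mod mask (Nat.pow 2 (Nat.pow 2 d))) off)
        (totientImage s d (Nat.shiftRight mask (Nat.pow 2 d)) (Nat.add off (Nat.pow 2 d)))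

/-- Iterates `S ↦ {φ (k ^ 2 + x) | x ∈ S}` for `k = f + 1, …, 2` on encoded sets, inserting `0` as
long as the index is at least `70`, and checks that the result is `{16}`. -/
noncomputable def descentCheck : ℕ → ℕ → Bool
  | 0, mask => Nat.beq mask 256
  | f + 1, mask => bif Nat.beq (Nat.shiftRight mask 32768) 0 then
      descentCheck f (Nat.lor (totientImage (Nat.pow (Nat.add f 2) 2) 15 mask 0)
        (bif Nat.ble 70 (Nat.add f 1) then 1 else 0))
      else false

theorem trialTotient_cons (p : ℕ) (ps : List ℕ) (m : ℕ) :
    trialTotient (p :: ps) m =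
      bif Nat.blt m (p * p) then (bif Nat.beq m 1 then 1 else m - 1)
      else bif Nat.beq (m % p) 0 then
        bif Nat.beq (m / p % p) 0 then Nat.totient m
          else (p - 1) * trialTotient ps (m / p)
      else trialTotient ps m := rfl

theorem totient_of_le_prime_factors {b m : ℕ} (hm : m ≠ 0) (hb : m < b * b)
    (h : ∀ q, q.Prime → q ∣ m → b ≤ q) :
    (bif Nat.beq m 1 then 1 else m - 1) = Nat.totient m := by
  by_cases h1 : m = 1
  · subst h1; rfl
  · have hp : m.Prime := by
      by_contra hnp
      have h2 := Nat.minFac_sq_le_self (Nat.pos_of_ne_zero hm) hnp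
      have h3 := h _ (Nat.minFac_prime h1) (Nat.minFac_dvd m)
      nlinarith
    have : Nat.beq m 1 = false := by
      rw [Bool.eq_false_iff]; simpa using h1
    rw [this, Nat.totient_prime hp]; rfl

theorem trialTotient_eq {b : ℕ} (ps : List ℕ) (hs : ps.Pairwise (· < ·))
    (hp : ∀ p ∈ ps, p.Prime) (hb : ∀ p ∈ ps, p ≤ b) (m : ℕ) (hm : m ≠ 0)
    (h : ∀ q, q.Prime → q ∣ m → q ∈ ps ∨ b ≤ q) :
    trialTotient ps m = Nat.totient m := by
  induction ps generalizing m with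
  | nil => rfl
  | cons p ps ih =>
    rw [List.pairwise_cons] at hs
    have hpp : p.Prime := hp p (by simp)
    have ih' := ih hs.2 (fun q hq => hp q (by simp [hq])) (fun q hq => hb q (by simp [hq]))
    rw [trialTotient_cons]
    cases h1 : Nat.blt m (p * p) with
    | true =>
      rw [Nat.blt_eq] at h1
      refine totient_of_le_prime_factors hm h1 fun q hq hqm => ?_
      rcases h q hq hqm with h2 | h2
      · rcases List.mem_cons.1 h2 with h3 | h3
        · exact h3.ge
        · exact (hs.1 q h3).le
      · exact (hb p (by simp)).trans h2
    | false =>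
      have key : ∀ m', m' ∣ m → ¬ p ∣ m' → trialTotient ps m' = Nat.totient m' := by
        intro m' hm' hpm'
        refine ih' m' (fun h0 => hm (by simpa [h0] using hm')) fun q hq hqm => ?_
        rcases h q hq (hqm.trans hm') with h2 | h2
        · rcases List.mem_cons.1 h2 with h3 | h3
          · exact absurd (h3 ▸ hqm) hpm'
          · exact Or.inl h3
        · exact Or.inr h2
      cases h2 : Nat.beq (m % p) 0 with
      | true =>
        have hd : p ∣ m := Nat.dvd_of_mod_eq_zero (Nat.eq_of_beq_eq_true h2)
        cases h3 : Nat.beq (m / p % p) 0 with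
        | true => rfl
        | false =>
          have hnd : ¬ p ∣ m / p := fun hd' =>
            Nat.ne_of_beq_eq_false h3 (Nat.mod_eq_zero_of_dvd hd')
          simp only [cond_true, cond_false]
          rw [key _ (Nat.div_dvd_of_dvd hd) hnd, ← Nat.totient_mul_of_prime_of_not_dvd hpp hnd,
            Nat.mul_div_cancel' hd]
      | false =>
        exact key m dvd_rfl fun hd => Nat.ne_of_beq_eq_false h2 (Nat.mod_eq_zero_of_dvd hd)

theorem mem_smallPrimes {p : ℕ} (hp : p.Prime) (h : p < 257) : p ∈ smallPrimes := by
  have : ∀ p < 257, p.Prime → p ∈ smallPrimes := by decide +kernel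
  exact this p h hp

theorem dvd_smallPrimorial {p : ℕ} (hp : p.Prime) (h : p < 257) : p ∣ smallPrimorial := by
  have : ∀ p ∈ smallPrimes, p ∣ smallPrimorial := by decide +kernel
  exact this p (mem_smallPrimes hp h)

theorem trialTotient_smallPrimes {m : ℕ} (hm : m ≠ 0) :
    trialTotient smallPrimes m = Nat.totient m := by
  refine trialTotient_eq (b := 257) smallPrimes (by decide +kernel) (by decide +kernel)
    (by decide +kernel) m hm fun q hq _ => ?_
  rcases lt_or_ge q 257 with h | h
  · exact Or.inl (mem_smallPrimes hq h)
  · exact Or.inr h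

theorem totient_eq_div_mul_totient {g n k : ℕ} (hn : n ≠ 0) (hg : g ∣ n) (hk : n ∣ g ^ k) :
    Nat.totient n = n / g * Nat.totient g := by
  have hg0 : g ≠ 0 := fun h => hn (by simpa [h] using hg)
  have hpf : n.primeFactors = g.primeFactors :=
    by
    refine Finset.Subset.antisymm (fun p hp => ?_) (Nat.primeFactors_mono hg hn)
    have hp' := Nat.prime_of_mem_primeFactors hp
    exact Nat.mem_primeFactors.2
      ⟨hp', hp'.dvd_of_dvd_pow ((Nat.dvd_of_mem_primeFactors hp).trans hk), hg0⟩
  have h1 := Nat.totient_mul_prod_primeFactors n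
  have h2 := Nat.totient_mul_prod_primeFactors g
  rw [hpf] at h1
  have hpos : 0 < ∏ p ∈ g.primeFactors, p :=
    Finset.prod_pos fun p hp => (Nat.prime_of_mem_primeFactors hp).pos
  refine Nat.eq_of_mul_eq_mul_right hpos ?_
  rw [h1, mul_assoc, h2, ← mul_assoc, Nat.div_mul_cancel hg]

theorem fastTotient_eq {m : ℕ} (hm : m ≠ 0) : fastTotient m = Nat.totient m := by
  change (bif (Nat.blt m 66049 && Nat.beq (Nat.gcd (Nat.gcd m (Nat.gcd m smallPrimorial ^ 16))
      (m / Nat.gcd m (Nat.gcd m smallPrimorial ^ 16))) 1) then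
      Nat.gcd m (Nat.gcd m smallPrimorial ^ 16) / Nat.gcd m smallPrimorial *
          trialTotient smallPrimes (Nat.gcd m smallPrimorial) *
        (bif Nat.beq (m / Nat.gcd m (Nat.gcd m smallPrimorial ^ 16)) 1 then 1
          else m / Nat.gcd m (Nat.gcd m smallPrimorial ^ 16) - 1)
    else Nat.totient m) = _
  set g := Nat.gcd m smallPrimorial with hg
  set G := Nat.gcd m (g ^ 16) with hG
  cases h : (Nat.blt m 66049 && Nat.beq (Nat.gcd G (m / G)) 1) with
  | false => rfl
  | true =>
    rw [Bool.and_eq_true, Nat.blt_eq] at h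
    have hco : Nat.Coprime G (m / G) := Nat.eq_of_beq_eq_true h.2
    have hGm : G ∣ m := Nat.gcd_dvd_left _ _
    have hG0 : G ≠ 0 := fun h0 => hm (by simpa [h0] using hGm)
    have hgm : g ∣ m := Nat.gcd_dvd_left _ _
    have hg0 : g ≠ 0 := fun h0 => hm (by simpa [h0] using hgm)
    have hgG : g ∣ G := Nat.dvd_gcd hgm (dvd_pow_self _ (by norm_num))
    have hq0 : m / G ≠ 0 := fun h0 => hm (by
      rw [← Nat.mul_div_cancel' hGm, h0, mul_zero])
    have hq : (bif Nat.beq (m / G) 1 then 1 else m / G - 1) = Nat.totient (m / G) := by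
      refine totient_of_le_prime_factors (b := 257) hq0
        ((Nat.div_le_self _ _).trans_lt h.1) fun r hr hrq => ?_
      by_contra! hlt
      have hrg : r ∣ g :=
        Nat.dvd_gcd (hrq.trans (Nat.div_dvd_of_dvd hGm)) (dvd_smallPrimorial hr hlt)
      exact Nat.not_coprime_of_dvd_of_dvd hr.one_lt (hrg.trans hgG) hrq hco
    rw [cond_true, hq, trialTotient_smallPrimes hg0,
      ← totient_eq_div_mul_totient hG0 hgG (Nat.gcd_dvd_right _ _), ← Nat.totient_mul hco,
      Nat.mul_div_cancel' hGm]

theorem testBit_totientImage {s : ℕ} (hs : s ≠ 0) (d : ℕ) {mask off i : ℕ} (hi : i < 2 ^ d)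
    (h : mask.testBit i = true) :
    (totientImage s d mask off).testBit (Nat.totient (s + 2 * (off + i)) / 2) = true := by
  have hmask : Nat.beq mask 0 = false := by
    rw [Bool.eq_false_iff]
    intro h0
    rw [Nat.eq_of_beq_eq_true h0] at h
    simp at h
  induction d generalizing mask off i with
  | zero =>
    obtain rfl : i = 0 := by simpa using hi
    change (bif Nat.beq mask 0 then 0 else
      1 <<< (fastTotient (s + 2 * off) / 2)).testBit _ = true
    rw [hmask, fastTotient_eq (by omega)]
    simp
  | succ d ih =>
    change (bif Nat.beq mask 0 then 0 else
      totientImage s d (mask % 2 ^ 2 ^ d) off |||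
        totientImage s d (mask >>> 2 ^ d) (off + 2 ^ d)).testBit _ = true
    have beq_false {x j : ℕ} (hx : x.testBit j = true) : Nat.beq x 0 = false := by
      rw [Bool.eq_false_iff]
      intro h0
      rw [Nat.eq_of_beq_eq_true h0] at hx
      simp at hx
    rw [hmask, cond_false, Nat.testBit_or, Bool.or_eq_true]
    rcases lt_or_ge i (2 ^ d) with hlt | hge
    · have h' : (mask % 2 ^ 2 ^ d).testBit i = true := by
        rw [Nat.testBit_mod_two_pow]; simp [hlt, h]
      exact Or.inl (ih hlt h' (beq_false h'))
    · obtain ⟨j, rfl⟩ := Nat.exists_eq_add_of_le hge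
      have h' : (mask >>> 2 ^ d).testBit j = true := by
        rw [Nat.testBit_shiftRight]; exact h
      have := ih (off := off + 2 ^ d) (by rw [pow_succ] at hi; omega) h' (beq_false h')
      rw [add_assoc] at this
      exact Or.inr this

theorem scorePartial_sub {a : ℕ → ℕ} {n k : ℕ} (hk : k < n) :
    scorePartial a n (n - k) =
      Nat.totient (a (k + 1) + scorePartial a n (n - (k + 1))) := by
  obtain ⟨j, rfl⟩ : ∃ j, n = k + 1 + j := ⟨n - (k + 1), by omega⟩
  rw [show k + 1 + j - k = j + 1 by omega, show k + 1 + j - (k + 1) = j by omega]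
  change Nat.totient (a (k + 1 + j - j) + _) = _
  rw [Nat.add_sub_cancel]

theorem even_scorePartial_sq {n k : ℕ} (hk : 1 ≤ k) (hkn : k ≤ n) :
    Even (scorePartial (fun j => j ^ 2) n (n - k)) := by
  rcases hkn.eq_or_lt with rfl | h
  · simp [scorePartial]
  · rw [scorePartial_sub h]
    exact Nat.totient_even (by nlinarith)

theorem two_mul_totient_le_of_even {m : ℕ} (hm : Even m) : 2 * Nat.totient m ≤ m := by
  induction m using Nat.strong_induction_on with
  | _ m ih =>
    obtain ⟨r, rfl⟩ := hm
    rw [← two_mul]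
    rcases Nat.even_or_odd r with h | h
    · rw [Nat.totient_two_mul_of_even h]
      rcases Nat.eq_zero_or_pos r with rfl | h0
      · simp
      · exact Nat.mul_le_mul_left 2 (ih r (by omega) h)
    · rw [Nat.totient_two_mul_of_odd h]
      exact Nat.mul_le_mul_left 2 (Nat.totient_le r)

theorem scorePartial_sq_le {n k : ℕ} (hk : Odd k) (hkn : k ≤ n) :
    scorePartial (fun j => j ^ 2) n (n - k) ≤ 2 * k ^ 2 + 14 * k + 41 := by
  induction hm : n - k using Nat.strong_induction_on generalizing k with
  | _ m ih =>
    subst hm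
    rcases hkn.eq_or_lt with rfl | h
    · simp [scorePartial]
    · have heven : Even ((k + 1) ^ 2 + scorePartial (fun j => j ^ 2) n (n - (k + 1))) :=
        (hk.add_one.pow_of_ne_zero two_ne_zero).add (even_scorePartial_sq (by omega) (by omega))
      have h1 := two_mul_totient_le_of_even heven
      rw [scorePartial_sub h]
      rcases (Nat.succ_le_of_lt h).eq_or_lt with h2 | h2
      · subst h2
        simp only [Nat.succ_eq_add_one, Nat.sub_self, scorePartial] at h1 ⊢
        nlinarith
      · have h3 := ih (n - (k + 2)) (by omega) (k := k + 2) (hk.add_even even_two) h2 rfl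
        have h4 := scorePartial_sub (a := fun j => j ^ 2) h2
        have h5 := Nat.totient_le
          ((k + 1 + 1) ^ 2 + scorePartial (fun j => j ^ 2) n (n - (k + 1 + 1)))
        simp only [Nat.succ_eq_add_one, add_assoc, Nat.reduceAdd] at h1 h3 h4 h5 ⊢
        nlinarith

theorem scorePartial_sq_one_of_descentCheck (f : ℕ) {n mask : ℕ} (hn : 70 ≤ n)
    (hf : descentCheck f mask = true)
    (h : f + 1 ≤ n →
      mask.testBit (scorePartial (fun j => j ^ 2) n (n - (f + 1)) / 2) = true) :
    scorePartial (fun j => j ^ 2) n (n - 1) = 16 := by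
  induction f generalizing mask with
  | zero =>
    rw [Nat.eq_of_beq_eq_true hf, show 256 = 2 ^ 8 from rfl, Nat.testBit_two_pow] at h
    have h1 := h (by omega)
    have h2 := even_scorePartial_sq (n := n) le_rfl (by omega)
    simp only [decide_eq_true_eq, zero_add] at h1
    obtain ⟨r, hr⟩ := h2
    omega
  | succ f ih =>
    simp only [descentCheck, Nat.add_eq, Nat.pow_eq, Nat.lor_eq, Nat.shiftRight_eq'] at hf
    cases h0 : Nat.beq (mask >>> 32768) 0 with
    | false => simp [h0] at hf
    | true =>
      rw [h0, cond_true] at hf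
      refine ih hf fun hfn => ?_
      rw [Nat.testBit_or, Bool.or_eq_true]
      rcases hfn.eq_or_lt with h1 | h1
      · right
        have : Nat.ble 70 (f + 1) = true := Nat.ble_eq_true_of_le (by omega)
        rw [this, h1, Nat.sub_self, cond_true]
        simp [scorePartial]
      · left
        have h2 := h h1
        have hlt : scorePartial (fun j => j ^ 2) n (n - (f + 1 + 1)) / 2 < 2 ^ 15 := by
          by_contra! hge
          obtain ⟨j, hj⟩ := Nat.exists_eq_add_of_le hge
          rw [hj, show 2 ^ 15 = 32768 from rfl, ← Nat.testBit_shiftRight,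
            Nat.eq_of_beq_eq_true h0] at h2
          simp at h2
        have h3 := testBit_totientImage (s := (f + 2) ^ 2) (by positivity) 15 (off := 0) hlt h2
        rw [zero_add, Nat.mul_div_cancel'
          (even_scorePartial_sq (n := n) (by omega) h1).two_dvd] at h3
        rw [scorePartial_sub h1]
        exact h3

theorem testBit_pred_two_pow {b i : ℕ} (h : i < b) :
    (Nat.pred (Nat.pow 2 b)).testBit i = true := by
  simp [Nat.pred_eq_sub_one, Nat.testBit_two_pow_sub_one, h]

theorem descentCheck_initial : descentCheck 118 (Nat.pred (Nat.pow 2 15015)) = true := by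
  decide +kernel

theorem stmt_12 (n : ℕ) (hn : 70 ≤ n) :
    scorePartial (fun j => j ^ 2) n n = 16 := by
  have h1 : scorePartial (fun j => j ^ 2) n (n - 1) = 16 := by
    refine scorePartial_sq_one_of_descentCheck 118 hn descentCheck_initial fun h => ?_
    have hb := scorePartial_sq_le (n := n) (k := 119) (by decide) h
    obtain ⟨r, hr⟩ := even_scorePartial_sq (n := n) (k := 119) (by omega) h
    exact testBit_pred_two_pow (by norm_num at hb hr ⊢; omega)
  have h2 := scorePartial_sub (a := fun j => j ^ 2) (n := n) (k := 0) (by omega)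
  rw [Nat.sub_zero, zero_add, h1] at h2
  rw [h2]
  decide
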